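/- Let f be convex and L-smooth on a real inner product space, let δ ∈ (0,1), let h satisfy 3/(2(1+δ)) ≤ h ≤ (3δ+2-√(4-3δ²))/(2δ(δ+1)), and let x1 = x0 - (h/L)·d0 where d0 satisfies ‖d0 - ∇f(x0)‖ ≤ δ‖∇f(x0)‖. Let λ̃ be the largest real root of the cubic [(δ²-1)h²+2h]λ³ + [2(δ²-1)h²+5h-4]λ² + [(δ²-1)h²+4h-4]λ + (h-1) = 0 (i.e. λ̃ is a real root and every real root μ satisfies μ ≤ λ̃); assume λ̃ > 0 and h·λ̃² + 2(h-1)·λ̃ + h - 1 > 0. Then (1/L)·‖∇f(x1)‖² ≤ (2λ̃ / (h·λ̃² + 2(h-1)·λ̃ + h - 1)) · (f(x0) - f(x1)). -/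

import Mathlib

theorem aux_hasDerivAt {H : Type*} [NormedAddCommGroup H] [InnerProductSpace ℝ H] [CompleteSpace H]
    (f : H → ℝ) (f' : H → H) (hgrad : ∀ x, HasGradientAt f (f' x) x) (x v : H) (t : ℝ) :
    HasDerivAt (fun s : ℝ => f (x + s • v)) (inner ℝ (f' (x + t • v)) v) t := by
  have h1 : HasDerivAt (fun s : ℝ => x + s • v) v t := by
    simpa using ((hasDerivAt_id t).smul_const v).const_add x
  have h2 := (hgrad (x + t • v)).hasFDerivAt.comp_hasDerivAt t h1
  simpa [Function.comp_def] using h2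

theorem aux_convex {H : Type*} [NormedAddCommGroup H] [InnerProductSpace ℝ H] [CompleteSpace H]
    (f : H → ℝ) (f' : H → H) (hconv : ConvexOn ℝ Set.univ f)
    (hgrad : ∀ x, HasGradientAt f (f' x) x) (x v : H) :
    f x + inner ℝ (f' x) v ≤ f (x + v) := by
  have hc : ConvexOn ℝ Set.univ (fun s : ℝ => f (x + s • v)) := by
    refine ⟨convex_univ, ?_⟩
    intro s _ t _ a b ha hb hab
    have := hconv.2 (Set.mem_univ (x + s • v)) (Set.mem_univ (x + t • v)) ha hb hab
    have e : x + (a • s + b • t) • v = a • (x + s • v) + b • (x + t • v) := by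
      have : x = (a + b) • x := by rw [hab, one_smul]
      conv_lhs => rw [this]
      simp only [smul_eq_mul]
      module
    simpa only [e] using this
  have hd := aux_hasDerivAt f f' hgrad x v 0
  have := hc.le_slope_of_hasDerivAt (Set.mem_univ 0) (Set.mem_univ 1) one_pos hd
  simp [slope_def_field] at this
  linarith

theorem aux_descent {H : Type*} [NormedAddCommGroup H] [InnerProductSpace ℝ H] [CompleteSpace H]
    (f : H → ℝ) (f' : H → H) (L : ℝ) (hL : 0 < L)
    (hgrad : ∀ x, HasGradientAt f (f' x) x)
    (hlip : LipschitzWith L.toNNReal f') (x v : H) :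
    f (x + v) ≤ f x + inner ℝ (f' x) v + L / 2 * ‖v‖ ^ 2 := by
  have hd : ∀ t : ℝ, HasDerivAt
      (fun s : ℝ => f (x + s • v) - s * inner ℝ (f' x) v - s ^ 2 * (L / 2 * ‖v‖ ^ 2))
      (inner ℝ (f' (x + t • v)) v - 1 * inner ℝ (f' x) v
        - (2 * t) * (L / 2 * ‖v‖ ^ 2)) t := by
    intro t
    refine ((aux_hasDerivAt f f' hgrad x v t).sub ((hasDerivAt_id t).mul_const _)).sub ?_
    simpa using (hasDerivAt_pow 2 t).mul_const (L / 2 * ‖v‖ ^ 2)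
  have hanti : AntitoneOn
      (fun s : ℝ => f (x + s • v) - s * inner ℝ (f' x) v - s ^ 2 * (L / 2 * ‖v‖ ^ 2))
      (Set.Icc 0 1) := by
    refine antitoneOn_of_deriv_nonpos (convex_Icc 0 1)
      (fun t _ => (hd t).continuousAt.continuousWithinAt)
      (fun t _ => (hd t).differentiableAt.differentiableWithinAt) ?_
    intro t ht
    rw [interior_Icc] at ht
    rw [(hd t).deriv]
    have h1 := hlip.dist_le_mul (x + t • v) x
    rw [dist_eq_norm, dist_eq_norm, Real.coe_toNNReal _ hL.le, add_sub_cancel_left, norm_smul,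
      Real.norm_of_nonneg ht.1.le] at h1
    have h2 := real_inner_le_norm (f' (x + t • v) - f' x) v
    rw [inner_sub_left] at h2
    have h3 := mul_le_mul_of_nonneg_right h1 (norm_nonneg v)
    nlinarith
  have := hanti (Set.left_mem_Icc.2 zero_le_one) (Set.right_mem_Icc.2 zero_le_one) zero_le_one
  simp at this
  linarith

theorem aux_interp {H : Type*} [NormedAddCommGroup H] [InnerProductSpace ℝ H] [CompleteSpace H]
    (f : H → ℝ) (f' : H → H) (L : ℝ) (hL : 0 < L)
    (hconv : ConvexOn ℝ Set.univ f)
    (hgrad : ∀ x, HasGradientAt f (f' x) x)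
    (hlip : LipschitzWith L.toNNReal f') (x y : H) :
    f x + inner ℝ (f' x) (y - x) + 1 / (2 * L) * ‖f' y - f' x‖ ^ 2 ≤ f y := by
  set w := f' y - f' x with hw
  have h1 := aux_descent f f' L hL hgrad hlip y (-(1 / L) • w)
  have h2 := aux_convex f f' hconv hgrad x (y - x + -(1 / L) • w)
  have e : x + (y - x + -(1 / L) • w) = y + -(1 / L) • w := by abel
  rw [e, inner_add_right] at h2
  have h3 : inner ℝ (f' y) w - inner ℝ (f' x) w = ‖w‖ ^ 2 := by
    rw [← inner_sub_left, ← hw, real_inner_self_eq_norm_sq]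
  rw [inner_smul_right] at h1 h2
  have h4 : ‖-(1 / L) • w‖ ^ 2 = (1 / L) ^ 2 * ‖w‖ ^ 2 := by
    rw [norm_smul, mul_pow, Real.norm_eq_abs, sq_abs]; ring
  rw [h4] at h1
  have h5 : L / 2 * ((1 / L) ^ 2 * ‖w‖ ^ 2) = 1 / (2 * L) * ‖w‖ ^ 2 := by field_simp
  have h6 : 1 / L * (inner ℝ (f' y) w - inner ℝ (f' x) w) = 2 * (1 / (2 * L) * ‖w‖ ^ 2) := by
    rw [h3]; field_simp
  rw [h5] at h1
  linarith

theorem aux_h_lt (δ h : ℝ) (hδ : δ ∈ Set.Ioo (0 : ℝ) 1)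
    (hub : h ≤ (3 * δ + 2 - Real.sqrt (4 - 3 * δ ^ 2)) / (2 * δ * (δ + 1))) : h < 3 / 2 := by
  obtain ⟨h0, h1⟩ := hδ
  refine hub.trans_lt ?_
  rw [div_lt_iff₀ (by positivity)]
  have : 2 - 3 * δ ^ 2 < Real.sqrt (4 - 3 * δ ^ 2) := by
    apply Real.lt_sqrt_of_sq_lt
    have : δ ^ 2 < 1 := by nlinarith
    have : 0 < δ ^ 2 := by positivity
    nlinarith
  nlinarith

theorem aux_N_pos (δ h l : ℝ) (hδ : 0 < δ) (h0 : 0 < h) (hh : h < 3 / 2) (hl : 0 < l)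
    (hroot : h ^ 2 * δ ^ 2 * l * (1 + l) ^ 2
      = ((2 - h) * l + 1 - h) * (1 + (2 - h) * l - h * l ^ 2)) :
    0 < (2 - h) * l + 1 - h := by
  by_contra hN
  push Not at hN
  have hl1 : l < 1 := by nlinarith
  have hQ : 0 < 1 + (2 - h) * l - h * l ^ 2 := by
    nlinarith [mul_pos hl (sub_pos.2 hl1), mul_pos h0 (mul_pos hl (sub_pos.2 hl1))]
  have : 0 < h ^ 2 * δ ^ 2 * l * (1 + l) ^ 2 := by positivity
  nlinarith [mul_nonneg (neg_nonneg.2 hN) hQ.le]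

/-- One step of relatively inexact gradient descent (inexactness `δ ∈ (0,1)`)
on a convex `L`-smooth function, intermediate regime
`3/(2(1+δ)) ≤ h ≤ (3δ+2-√(4-3δ²))/(2δ(δ+1))`, where `lam` is the largest real root of the
cubic `[(δ²-1)h²+2h]λ³ + [2(δ²-1)h²+5h-4]λ² + [(δ²-1)h²+4h-4]λ + (h-1) = 0`:
`(1/L)·‖∇f(x1)‖² ≤ (2λ̃/(hλ̃² + 2(h-1)λ̃ + h-1)) · (f(x0) - f(x1))`. -/
theorem one_step_inexact_gd_intermediate_regime
    {H : Type*} [NormedAddCommGroup H] [InnerProductSpace ℝ H] [CompleteSpace H]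
    (f : H → ℝ) (f' : H → H) (L : ℝ) (hL : 0 < L)
    (hconv : ConvexOn ℝ Set.univ f)
    (hgrad : ∀ x, HasGradientAt f (f' x) x)
    (hlip : LipschitzWith L.toNNReal f')
    (δ : ℝ) (hδ : δ ∈ Set.Ioo (0 : ℝ) 1)
    (h : ℝ)
    (hlb : 3 / (2 * (1 + δ)) ≤ h)
    (hub : h ≤ (3 * δ + 2 - Real.sqrt (4 - 3 * δ ^ 2)) / (2 * δ * (δ + 1)))
    (lam : ℝ)
    (hroot : ((δ ^ 2 - 1) * h ^ 2 + 2 * h) * lam ^ 3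
        + (2 * (δ ^ 2 - 1) * h ^ 2 + 5 * h - 4) * lam ^ 2
        + ((δ ^ 2 - 1) * h ^ 2 + 4 * h - 4) * lam + (h - 1) = 0)
    (hlargest : ∀ μ : ℝ, ((δ ^ 2 - 1) * h ^ 2 + 2 * h) * μ ^ 3
        + (2 * (δ ^ 2 - 1) * h ^ 2 + 5 * h - 4) * μ ^ 2
        + ((δ ^ 2 - 1) * h ^ 2 + 4 * h - 4) * μ + (h - 1) = 0 → μ ≤ lam)
    (hlam_pos : 0 < lam)
    (hden_pos : 0 < h * lam ^ 2 + 2 * (h - 1) * lam + h - 1)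
    (x0 d0 x1 : H)
    (hd0 : ‖d0 - f' x0‖ ≤ δ * ‖f' x0‖)
    (hx1 : x1 = x0 - (h / L) • d0) :
    (1 / L) * ‖f' x1‖ ^ 2 ≤
      (2 * lam / (h * lam ^ 2 + 2 * (h - 1) * lam + h - 1)) * (f x0 - f x1) := by
  obtain ⟨hδ0, hδ1⟩ := hδ
  have hh := aux_h_lt δ h ⟨hδ0, hδ1⟩ hub
  have h0 : 0 < h := lt_of_lt_of_le (by positivity) hlb
  have hroot' : h ^ 2 * δ ^ 2 * lam * (1 + lam) ^ 2
      = ((2 - h) * lam + 1 - h) * (1 + (2 - h) * lam - h * lam ^ 2) := by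
    linear_combination hroot
  have hN := aux_N_pos δ h lam hδ0 h0 hh hlam_pos hroot'
  have i01 := aux_interp f f' L hL hconv hgrad hlip x1 x0
  have i10 := aux_interp f f' L hL hconv hgrad hlip x0 x1
  have e1 : x0 - x1 = (h / L) • d0 := by rw [hx1]; abel
  have e2 : x1 - x0 = -((h / L) • d0) := by rw [hx1]; abel
  rw [e1, inner_smul_right] at i01
  rw [e2, inner_neg_right, inner_smul_right] at i10
  have hE : ‖d0 - f' x0‖ ^ 2 ≤ δ ^ 2 * ‖f' x0‖ ^ 2 := by
    rw [← mul_pow]; exact pow_le_pow_left₀ (norm_nonneg _) hd0 2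
  -- the square completing the certificate
  have hS : 0 ≤ ‖(h * lam * (1 + lam)) • d0
      - (lam * (h * (1 + lam) + ((2 - h) * lam + 1 - h))) • f' x0
      + ((1 + lam) * ((2 - h) * lam + 1 - h)) • f' x1‖ ^ 2 := by positivity
  generalize f' x0 = g0 at *
  generalize f' x1 = g1 at *
  simp only [← real_inner_self_eq_norm_sq, inner_add_left, inner_add_right, inner_sub_left,
    inner_sub_right, real_inner_smul_left, real_inner_smul_right] at i01 i10 hE hS ⊢
  rw [real_inner_comm g0 d0] at *
  rw [real_inner_comm g1 d0] at *
  rw [real_inner_comm g1 g0] at *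
  generalize inner ℝ d0 d0 = dd at *
  generalize inner ℝ g0 g0 = g00 at *
  generalize inner ℝ g1 g1 = g11 at *
  generalize inner ℝ g0 d0 = dg0 at *
  generalize inner ℝ g1 d0 = dg1 at *
  generalize inner ℝ g1 g0 = g01 at *
  set N := (2 - h) * lam + 1 - h with hNdef
  have j01 : h * dg1 + (g00 - 2 * g01 + g11) / 2 ≤ L * (f x0 - f x1) := by
    have := mul_le_mul_of_nonneg_left i01 hL.le
    have e : L * (f x1 + h / L * dg1 + 1 / (2 * L) * (g00 - g01 - (g01 - g11)))
      = L * f x1 + (h * dg1 + (g00 - 2 * g01 + g11) / 2) := by field_simp; ring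
    linarith
  have j10 : -h * dg0 + (g00 - 2 * g01 + g11) / 2 ≤ L * (f x1 - f x0) := by
    have := mul_le_mul_of_nonneg_left i10 hL.le
    have e : L * (f x0 + -(h / L * dg0) + 1 / (2 * L) * (g11 - g01 - (g01 - g00)))
      = L * f x0 + (-h * dg0 + (g00 - 2 * g01 + g11) / 2) := by field_simp; ring
    linarith
  have k01 := mul_le_mul_of_nonneg_left j01
    (show 0 ≤ N * (1 + lam) * (2 * lam * (1 + lam)) by positivity)
  have k10 := mul_le_mul_of_nonneg_left j10
    (show 0 ≤ N * (1 + lam) * (2 * lam ^ 2) by positivity)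
  have kE := mul_le_mul_of_nonneg_left hE
    (show 0 ≤ h ^ 2 * lam ^ 2 * (1 + lam) ^ 2 by positivity)
  have key : 0 ≤ N * (1 + lam) * (2 * lam * (L * (f x0 - f x1))
      - (h * lam ^ 2 + 2 * (h - 1) * lam + h - 1) * g11) := by
    have hr := congrArg (fun z => z * (lam * g00)) hroot'
    simp only [hNdef] at *
    linarith
  have key2 := nonneg_of_mul_nonneg_right key (by positivity)
  rw [div_mul_eq_mul_div, div_mul_eq_mul_div, div_le_div_iff₀ hL hden_pos]
  linarith
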